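/- There do not exist eight segments labeled d, e, f, 1, 2, 3, 4, 5, all of whose 16 endpoints lie on the parabola y = x² and have pairwise distinct x-coordinates appearing in the left-to-right order L_d, L_e, L₁, L₂, L_f, R_d, L₃, L₄, R_e, R_f, L₅, R₁, R₂, R₃, R₄, R₅ (where L_s and R_s denote the left and right endpoints of segment s), such that simultaneously: the segments d, e, f intersect concavely; and the segments 1, 2, 3, 4, 5 form a wide set and intersect concavely. -/

import Mathlib

/-- The point of the parabola `y = x²` with x-coordinate `t`. -/
noncomputable def Ppt (t : ℝ) : ℝ × ℝ := (t, t ^ 2)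

/-- The closed straight-line segment between the points of the parabola with
x-coordinates `a` and `b`. -/
noncomputable def Seg (a b : ℝ) : Set (ℝ × ℝ) := segment ℝ (Ppt a) (Ppt b)

/-- For three segments `s₁ = [P aL, P aR]`, `s₂ = [P bL, P bR]`, `s₃ = [P cL, P cR]`
with endpoints on the parabola: the intersection point `s₃ ∩ s₂` lies strictly to
the left of the intersection point `s₂ ∩ s₁`.  A family `s₁, …, sₘ` intersects
concavely exactly when this holds for every three consecutive members. -/
noncomputable def XLt (aL aR bL bR cL cR : ℝ) : Prop :=
  ∀ z w : ℝ × ℝ, z ∈ Seg cL cR ∩ Seg bL bR → w ∈ Seg bL bR ∩ Seg aL aR → z.1 < w.1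

theorem mem_Seg {a c x y : ℝ} (hac : a < c) (h1 : a ≤ x) (h2 : x ≤ c)
    (hy : y = (a + c) * x - a * c) : (x, y) ∈ Seg a c := by
  have hp : 0 < c - a := by linarith
  refine ⟨(c - x) / (c - a), (x - a) / (c - a), div_nonneg (by linarith) hp.le,
    div_nonneg (by linarith) hp.le, by field_simp; ring, ?_⟩
  subst hy
  ext
  · simp only [Ppt, Prod.fst_add, Prod.smul_fst, smul_eq_mul]
    field_simp
    ring
  · simp only [Ppt, Prod.snd_add, Prod.smul_snd, smul_eq_mul]
    field_simp
    ring

theorem exists_inter {a b c d : ℝ} (h1 : a < b) (h2 : b < c) (h3 : c < d) :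
    ∃ z : ℝ × ℝ, z ∈ Seg a c ∧ z ∈ Seg b d ∧ b < z.1 ∧ z.1 < c ∧
      (z.1 - a) * (c - z.1) = (z.1 - b) * (d - z.1) := by
  have hp : 0 < b + d - a - c := by linarith
  obtain ⟨x, hx⟩ : ∃ x : ℝ, x * (b + d - a - c) = b * d - a * c :=
    ⟨(b * d - a * c) / (b + d - a - c), by field_simp⟩
  have hb : b < x := by
    have : 0 < (x - b) * (b + d - a - c) := by
      have : (x - b) * (b + d - a - c) = (b - a) * (c - b) := by linear_combination hx
      rw [this]; exact mul_pos (by linarith) (by linarith)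
    linarith [pos_of_mul_pos_left this hp.le]
  have hc : x < c := by
    have : 0 < (c - x) * (b + d - a - c) := by
      have : (c - x) * (b + d - a - c) = (d - c) * (c - b) := by linear_combination -hx
      rw [this]; exact mul_pos (by linarith) (by linarith)
    linarith [pos_of_mul_pos_left this hp.le]
  refine ⟨(x, (a + c) * x - a * c), mem_Seg (by linarith) (by linarith) (by linarith) rfl,
    mem_Seg (by linarith) (by linarith) (by linarith) (by linear_combination -hx), hb, hc, ?_⟩
  show (x - a) * (c - x) = (x - b) * (d - x)
  linear_combination -hx

theorem XLt_key {a b c a' b' c' : ℝ} (h1 : a < b) (h2 : b < c) (h3 : c < a') (h4 : a' < b')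
    (h5 : b' < c') (h : XLt a a' b b' c c') :
    ∃ x y : ℝ, x < y ∧ c < x ∧ y < a' ∧ (x - b) * (b' - x) = (x - c) * (c' - x) ∧
      (y - a) * (a' - y) = (y - b) * (b' - y) := by
  obtain ⟨z, z1, z2, z3, z4, z5⟩ := exists_inter h2 (h3.trans h4) h5
  obtain ⟨w, w1, w2, w3, w4, w5⟩ := exists_inter h1 (h2.trans h3) h4
  exact ⟨z.1, w.1, h z w ⟨z2, z1⟩ ⟨w2, w1⟩, z3, w4, z5, w5⟩

theorem wide_key {o a b c a' b' c' : ℝ} (ho : o ≤ a) (h1 : a < b) (h2 : b < c) (h3 : c < a')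
    (h4 : a' < b') (h5 : b' < c') (hw : b' - o > 2 * (a' - o)) (h : XLt a a' b b' c c') :
    c - b < b - a := by
  obtain ⟨x, y, hxy, hcx, hya, -, hy⟩ := XLt_key h1 h2 h3 h4 h5 h
  have k1 : 2 * (a' - y) < b' - y := by linarith
  have k2 : (y - b) * (2 * (a' - y)) < (y - b) * (b' - y) :=
    mul_lt_mul_of_pos_left k1 (by linarith)
  have k3 : 0 < ((y - a) - 2 * (y - b)) * (a' - y) := by linarith
  have := pos_of_mul_pos_left k3 (by linarith)
  linarith

/-- Lemma `lem_smash_wide`: there are no eight segments `d, e, f, 1, 2, 3, 4, 5`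
with all endpoints on the parabola `y = x²`, whose endpoints appear in the
left-to-right order `L_d L_e L₁ L₂ L_f R_d L₃ L₄ R_e R_f L₅ R₁ R₂ R₃ R₄ R₅`,
such that the segments `d, e, f` intersect concavely and the segments
`1, 2, 3, 4, 5` form a wide set and intersect concavely. -/
theorem lem_smash_wide :
    ¬ ∃ ld le l1 l2 lf rd l3 l4 re rf l5 r1 r2 r3 r4 r5 : ℝ,
      (ld < le ∧ le < l1 ∧ l1 < l2 ∧ l2 < lf ∧ lf < rd ∧ rd < l3 ∧ l3 < l4 ∧
        l4 < re ∧ re < rf ∧ rf < l5 ∧ l5 < r1 ∧ r1 < r2 ∧ r2 < r3 ∧ r3 < r4 ∧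
        r4 < r5) ∧
      -- segments d, e, f intersect concavely
      XLt ld rd le re lf rf ∧
      -- segments 1, 2, 3, 4, 5 form a wide set
      (r2 - l1 > 2 * (r1 - l1) ∧ r3 - l1 > 2 * (r2 - l1) ∧
        r4 - l1 > 2 * (r3 - l1) ∧ r5 - l1 > 2 * (r4 - l1)) ∧
      -- segments 1, 2, 3, 4, 5 intersect concavely
      XLt l1 r1 l2 r2 l3 r3 ∧ XLt l2 r2 l3 r3 l4 r4 ∧ XLt l3 r3 l4 r4 l5 r5 := by
  rintro ⟨ld, le, l1, l2, lf, rd, l3, l4, re, rf, l5, r1, r2, r3, r4, r5,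
    ⟨a1, a2, a3, a4, a5, a6, a7, a8, a9, a10, a11, a12, a13, a14, a15⟩, hd,
    ⟨w1, w2, w3, w4⟩, c1, c2, c3⟩
  have e1 : l3 - l2 < l2 - l1 := wide_key le_rfl a3 (by linarith) (by linarith) a12 a13 w1 c1
  have e2 : l5 - l4 < l4 - l3 :=
    wide_key (o := l1) (by linarith) a7 (by linarith) (by linarith) a14 a15 w3 c3
  obtain ⟨x, y, hxy, hx, hy, ex, -⟩ :=
    XLt_key a1 (by linarith) a5 (by linarith) a9 hd
  -- at `x`: `x - le > 2 (x - lf)` and `rf - x < 2 (re - x)`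
  have k1 : 2 * (x - lf) < x - le := by linarith
  have k2 : rf - x < 2 * (re - x) := by linarith
  have k3 : 2 * (x - lf) * (re - x) < (x - le) * (re - x) :=
    mul_lt_mul_of_pos_right k1 (by linarith)
  have k4 : (x - lf) * (rf - x) < (x - lf) * (2 * (re - x)) :=
    mul_lt_mul_of_pos_left k2 (by linarith)
  linarith
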